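/- Let v be a positive function of class C³ on an open set of ℝ^N with Dv ≠ 0, let H be a norm of class C³ away from the origin, set V = H^p/p with p > 1 and W = ∇_ξ²V(Dv) D²v. Then for every γ ∈ ℝ the pointwise identity 2 v^γ S_2(W) = div( v^γ S²_{ij}(W) V_{ξ_i}(Dv) + γ(p−1) v^{γ−1} V(Dv) ∇_ξV(Dv) ) − γ(γ−1) p (p−1) v^{γ−2} V(Dv)² − γ(2p−1) v^{γ−1} V(Dv) Δ_p^H v holds. -/

import Mathlib

open MeasureTheory Filter Set
open scoped Topology RealInnerProductSpace NNReal

noncomputable section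

abbrev Euc (N : ℕ) := EuclideanSpace ℝ (Fin N)

variable {N : ℕ}

/-- The partial derivative of `f` in the `i`-th coordinate direction. -/
def pd (i : Fin N) (f : Euc N → ℝ) (x : Euc N) : ℝ :=
  fderiv ℝ f x (EuclideanSpace.single i 1)

/-- The Hessian matrix of `f` at `x`. -/
def hessM (f : Euc N → ℝ) (x : Euc N) : Matrix (Fin N) (Fin N) ℝ :=
  Matrix.of fun i j => pd i (pd j f) x

/-- Interpret a plain function `Fin N → ℝ` as a point of Euclidean space. -/
def toEuc {N : ℕ} (f : Fin N → ℝ) : Euc N := (WithLp.equiv 2 (Fin N → ℝ)).symm f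

/-- The divergence of a vector field. -/
def divVF (X : Euc N → Euc N) (x : Euc N) : ℝ := ∑ i, pd i (fun y => X y i) x

/-- The quadratic form associated to a matrix. -/
def qForm (A : Matrix (Fin N) (Fin N) ℝ) (ζ : Euc N) : ℝ := ∑ i, ∑ j, A i j * ζ i * ζ j

/-- Local `α`-Hölder continuity of `g` on `s` (uniform on compact subsets). -/
def LocHolderOn {X Y : Type*} [NormedAddCommGroup X] [NormedAddCommGroup Y]
    (α : ℝ) (g : X → Y) (s : Set X) : Prop :=
  ∀ K : Set X, K ⊆ s → IsCompact K → ∃ C : ℝ, ∀ x ∈ K, ∀ y ∈ K, ‖g x - g y‖ ≤ C * ‖x - y‖ ^ α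

/-- The dual norm `H₀(x) = sup_{ξ ≠ 0} ⟨x, ξ⟩ / H(ξ)`. -/
def dualNorm (H : Euc N → ℝ) (x : Euc N) : ℝ :=
  ⨆ ξ : {ξ : Euc N // ξ ≠ 0}, ⟪x, (ξ : Euc N)⟫ / H ξ

/-- `V = H^p / p`. -/
def Vfun (H : Euc N → ℝ) (p : ℝ) : Euc N → ℝ := fun ξ => H ξ ^ p / p

/-- `H` is a norm of class `I_p`: a norm which is `C^{2,α}` away from the origin, for some
`α ∈ (0,1)`, such that `V = H^p/p` is `C²` away from the origin with Hessian having positive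
eigenvalues uniformly bounded away from `0` on the unit sphere. -/
structure IsIpNorm (p : ℝ) (H : Euc N → ℝ) : Prop where
  convex : ConvexOn ℝ Set.univ H
  homog : ∀ (t : ℝ) (ξ : Euc N), H (t • ξ) = |t| * H ξ
  pos : ∀ ξ : Euc N, ξ ≠ 0 → 0 < H ξ
  smooth : ContDiffOn ℝ 2 H {(0 : Euc N)}ᶜ
  holder : ∃ α ∈ Set.Ioo (0:ℝ) 1,
    LocHolderOn α (iteratedFDerivWithin ℝ 2 H {(0 : Euc N)}ᶜ) {(0 : Euc N)}ᶜ
  Vsmooth : ContDiffOn ℝ 2 (Vfun H p) {(0 : Euc N)}ᶜ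
  hessV_pos : ∃ c > 0, ∀ ξ : Euc N, ‖ξ‖ = 1 → ∀ ζ : Euc N,
    c * ‖ζ‖ ^ 2 ≤ qForm (hessM (Vfun H p) ξ) ζ

/-- `Ω` is, up to a translation, the Wulff shape `B_{H₀}(r)` of `H` for some `r > 0`. -/
def IsWulffShape (H : Euc N → ℝ) (Ω : Set (Euc N)) : Prop :=
  ∃ (x₀ : Euc N) (r : ℝ), 0 < r ∧ Ω = {x | dualNorm H (x - x₀) < r}

/-- An open set with boundary of class `C^{2,α}`, described by a `C^{2,α}` defining function. -/
def IsC2alphaDomain (Ω : Set (Euc N)) : Prop :=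
  IsOpen Ω ∧ ∃ f : Euc N → ℝ, ContDiff ℝ 2 f ∧
    (∃ α ∈ Set.Ioo (0:ℝ) 1, LocHolderOn α (iteratedFDeriv ℝ 2 f) (Set.univ : Set (Euc N))) ∧
    Ω = {x | f x < 0} ∧ frontier Ω = {x | f x = 0} ∧
    ∀ x ∈ frontier Ω, gradient f x ≠ 0

/-- Weak solution of `Δ_p^H u = -1` in `Ω`, `u = 0` on `∂Ω`. -/
structure IsInteriorSol (H : Euc N → ℝ) (p : ℝ) (Ω : Set (Euc N)) (u : Euc N → ℝ) : Prop where
  contOn : ContinuousOn u (closure Ω)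
  diff : ∀ x ∈ Ω, DifferentiableAt ℝ u x
  bdry : ∀ x ∈ frontier Ω, u x = 0
  int_u : IntegrableOn u Ω
  int_grad : IntegrableOn (fun x => H (gradient u x) ^ p) Ω
  weak : ∀ φ : Euc N → ℝ, ContDiff ℝ 1 φ → HasCompactSupport φ → tsupport φ ⊆ Ω →
    (∫ x in Ω, H (gradient u x) ^ (p - 1) * ⟪gradient H (gradient u x), gradient φ x⟫)
      = ∫ x in Ω, φ x

/-- Solution of the exterior problem: `Δ_p^H u = 0` weakly in `ℝ^N ∖ cl Ω`, `u = 1` on `∂Ω`,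
`u → 0` at infinity. -/
structure IsExteriorSol (H : Euc N → ℝ) (p : ℝ) (Ω : Set (Euc N)) (u : Euc N → ℝ) : Prop where
  contOn : ContinuousOn u Ωᶜ
  diff : ∀ x ∈ (closure Ω)ᶜ, DifferentiableAt ℝ u x
  bdry : ∀ x ∈ frontier Ω, u x = 1
  decay : Tendsto u (cocompact (Euc N)) (𝓝 0)
  weak : ∀ φ : Euc N → ℝ, ContDiff ℝ 1 φ → HasCompactSupport φ → tsupport φ ⊆ (closure Ω)ᶜ →
    (∫ x in (closure Ω)ᶜ,
      H (gradient u x) ^ (p - 1) * ⟪gradient H (gradient u x), gradient φ x⟫) = 0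

/-- The inward unit normal field associated to a defining function `f` (with `Ω = {f < 0}`). -/
def inwardField (f : Euc N → ℝ) (x : Euc N) : Euc N := -(‖gradient f x‖)⁻¹ • gradient f x

/-- `ν` is the inward unit normal of `Ω` and `M` its anisotropic mean curvature
`M = -div(∇_ξ H(ν))`, computed via a `C²` defining function. -/
def IsNormalCurv (H : Euc N → ℝ) (Ω : Set (Euc N)) (ν : Euc N → Euc N) (M : Euc N → ℝ) : Prop :=
  ∃ f : Euc N → ℝ, ContDiff ℝ 2 f ∧ Ω = {x | f x < 0} ∧ frontier Ω = {x | f x = 0} ∧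
    (∀ x ∈ frontier Ω, gradient f x ≠ 0) ∧
    (∀ x ∈ frontier Ω, ν x = inwardField f x) ∧
    (∀ x ∈ frontier Ω, M x = - divVF (fun y => gradient H (inwardField f y)) x)

/-- `ν` is the inward unit normal field of `Ω`, computed via a `C²` defining function. -/
def IsInwardNormal (Ω : Set (Euc N)) (ν : Euc N → Euc N) : Prop :=
  ∃ f : Euc N → ℝ, ContDiff ℝ 2 f ∧ Ω = {x | f x < 0} ∧ frontier Ω = {x | f x = 0} ∧
    (∀ x ∈ frontier Ω, gradient f x ≠ 0) ∧
    ∀ x ∈ frontier Ω, ν x = inwardField f x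

/-- Second elementary symmetric function of a matrix. -/
def S2 (A : Matrix (Fin N) (Fin N) ℝ) : ℝ := ((Matrix.trace A) ^ 2 - Matrix.trace (A * A)) / 2

/-- `S²_{ij}(A) = -a_{ji} + δ_{ij} Tr A`. -/
def S2ij (A : Matrix (Fin N) (Fin N) ℝ) (i j : Fin N) : ℝ :=
  -A j i + (if i = j then Matrix.trace A else 0)

/-- The matrix `W = ∇²_ξ V(Dv) D²v`. -/
def Wmat (H : Euc N → ℝ) (p : ℝ) (v : Euc N → ℝ) (x : Euc N) : Matrix (Fin N) (Fin N) ℝ :=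
  hessM (Vfun H p) (gradient v x) * hessM v x

/-- `G` is the weak (distributional) Jacobian matrix of the vector field `Z` on `Ω`, with both
`Z` and `G` square-integrable (i.e. `Z ∈ W^{1,2}(Ω)` with Jacobian `G`). -/
def IsWeakJacobianOn (Z : Euc N → Euc N) (G : Euc N → Matrix (Fin N) (Fin N) ℝ)
    (Ω : Set (Euc N)) : Prop :=
  IntegrableOn (fun x => ∑ i, (Z x i) ^ 2) Ω ∧
  IntegrableOn (fun x => ∑ i, ∑ j, (G x i j) ^ 2) Ω ∧
  ∀ (i j : Fin N) (φ : Euc N → ℝ), ContDiff ℝ 1 φ → HasCompactSupport φ → tsupport φ ⊆ Ω →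
    (∫ x in Ω, Z x i * pd j φ x) = - ∫ x in Ω, G x i j * φ x

/-- The vector field `Z` belongs to `W^{1,2}(Ω)`. -/
def MemW12 (Z : Euc N → Euc N) (Ω : Set (Euc N)) : Prop := ∃ G, IsWeakJacobianOn Z G Ω


/-- The anisotropic `p`-capacity of `Ω`. -/
def pCapacity (H : Euc N → ℝ) (p : ℝ) (Ω : Set (Euc N)) : ℝ :=
  sInf {r : ℝ | ∃ φ : Euc N → ℝ, ContDiff ℝ (⊤ : ℕ∞) φ ∧ HasCompactSupport φ ∧
    (∀ x ∈ Ω, 1 ≤ φ x) ∧ r = (1 / p) * ∫ x, H (gradient φ x) ^ p}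

/-- The `(N-1)`-dimensional Hausdorff (surface) measure on `ℝ^N`. -/
def surf (N : ℕ) : Measure (Euc N) := Measure.hausdorffMeasure ((N : ℝ) - 1)

end

noncomputable section
open MeasureTheory Filter Set
open scoped Topology RealInnerProductSpace NNReal

section PartialDerivatives

variable {n : ℕ} {f g : Euc n → ℝ} {x : Euc n}

lemma gradient_apply_eq_pd (f : Euc n → ℝ) (x : Euc n) (i : Fin n) :
    gradient f x i = pd i f x := by
  have h : ⟪gradient f x, EuclideanSpace.single i (1 : ℝ)⟫ = pd i f x := by
    simp [gradient, pd]
  rw [← h, EuclideanSpace.inner_single_right]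
  simp

lemma pd_congr (i : Fin n) (h : f =ᶠ[𝓝 x] g) : pd i f x = pd i g x := by
  simp only [pd, h.fderiv_eq]

lemma pd_add (i : Fin n) (hf : DifferentiableAt ℝ f x) (hg : DifferentiableAt ℝ g x) :
    pd i (fun y => f y + g y) x = pd i f x + pd i g x := by
  simp [pd, fderiv_fun_add hf hg]

lemma pd_sub (i : Fin n) (hf : DifferentiableAt ℝ f x) (hg : DifferentiableAt ℝ g x) :
    pd i (fun y => f y - g y) x = pd i f x - pd i g x := by
  simp [pd, fderiv_fun_sub hf hg]

lemma pd_mul (i : Fin n) (hf : DifferentiableAt ℝ f x) (hg : DifferentiableAt ℝ g x) :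
    pd i (fun y => f y * g y) x = pd i f x * g x + f x * pd i g x := by
  simp [pd, fderiv_fun_mul hf hg]
  ring

lemma pd_const_mul (i : Fin n) (c : ℝ) (f : Euc n → ℝ) (x : Euc n) :
    pd i (fun y => c * f y) x = c * pd i f x := by
  have h : (fun y => c * f y) = c • f := rfl
  simp [pd, h, fderiv_const_smul_field]

lemma pd_sum {ι : Type*} (i : Fin n) {s : Finset ι} {F : ι → Euc n → ℝ}
    (hF : ∀ k ∈ s, DifferentiableAt ℝ (F k) x) :
    pd i (fun y => ∑ k ∈ s, F k y) x = ∑ k ∈ s, pd i (F k) x := by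
  simp [pd, fderiv_fun_sum hF]

lemma pd_rpow (i : Fin n) (hf : DifferentiableAt ℝ f x) (h : f x ≠ 0) (a : ℝ) :
    pd i (fun y => f y ^ a) x = a * f x ^ (a - 1) * pd i f x := by
  simp [pd, (hf.hasFDerivAt.rpow_const (p := a) (Or.inl h)).fderiv]

lemma ContDiffAt.pd {m k : WithTop ℕ∞} (hf : ContDiffAt ℝ k f x) (hmk : m + 1 ≤ k)
    (i : Fin n) : ContDiffAt ℝ m (pd i f) x :=
  (hf.fderiv_right hmk).clm_apply contDiffAt_const

lemma ContDiffAt.gradient {m k : WithTop ℕ∞} (hf : ContDiffAt ℝ k f x) (hmk : m + 1 ≤ k) :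
    ContDiffAt ℝ m (gradient f) x := by
  rw [contDiffAt_euclidean]
  intro i
  simp only [gradient_apply_eq_pd]
  exact hf.pd hmk i

lemma fderiv_apply_eq_sum_pd (f : Euc n → ℝ) (x w : Euc n) :
    fderiv ℝ f x w = ∑ i, pd i f x * w i := by
  have hw : w = ∑ i, w i • EuclideanSpace.single i (1 : ℝ) := by
    ext j
    simp [Finset.sum_apply, Pi.single_apply]
  conv_lhs => rw [hw]
  simp [pd, mul_comm]

lemma pd_comp {X : Euc n → Euc n} (i : Fin n) (hf : DifferentiableAt ℝ f (X x))
    (hX : DifferentiableAt ℝ X x) :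
    pd i (fun y => f (X y)) x = ∑ k, pd k f (X x) * pd i (fun y => X y k) x := by
  have hcoord (k : Fin n) : pd i (fun y => X y k) x
      = fderiv ℝ X x (EuclideanSpace.single i 1) k := by
    have := ((EuclideanSpace.proj (𝕜 := ℝ) k).hasFDerivAt.comp x hX.hasFDerivAt).fderiv
    simp only [pd]
    exact congrArg (fun T => T (EuclideanSpace.single i 1)) this
  simp only [hcoord]
  rw [← fderiv_apply_eq_sum_pd]
  simp only [pd]
  exact congrArg (fun T => T (EuclideanSpace.single i 1))
    (hf.hasFDerivAt.comp x hX.hasFDerivAt).fderiv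

lemma pd_pd_comm (hf : ContDiffAt ℝ 2 f x) (i j : Fin n) :
    pd i (pd j f) x = pd j (pd i f) x := by
  have hd : DifferentiableAt ℝ (fderiv ℝ f) x :=
    (hf.fderiv_right (m := 1) (by norm_num)).differentiableAt (by norm_num)
  have key (a b : Fin n) : pd a (pd b f) x
      = fderiv ℝ (fderiv ℝ f) x (EuclideanSpace.single a 1) (EuclideanSpace.single b 1) := by
    have h := (hd.hasFDerivAt.clm_apply
      (hasFDerivAt_const (EuclideanSpace.single b (1 : ℝ)) x)).fderiv
    have h' := congrArg (fun T => T (EuclideanSpace.single a 1)) h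
    simp only [ContinuousLinearMap.comp_zero, zero_add, ContinuousLinearMap.flip_apply] at h'
    exact h'
  rw [key, key]
  exact (hf.isSymmSndFDerivAt (by simp)).eq _ _

end PartialDerivatives

section Divergence

variable {n : ℕ} {x : Euc n} {F : Fin n → Euc n → ℝ}

/-- The `j`-th component of `S²(DF) F` for a vector field `F` with components `F j`. -/
def cofactorField (F : Fin n → Euc n → ℝ) (j : Fin n) (y : Euc n) : ℝ :=
  (∑ k, pd k (F k) y) * F j y - ∑ i, pd i (F j) y * F i y

lemma differentiableAt_cofactorField (hF : ∀ k, ContDiffAt ℝ 2 (F k) x) (j : Fin n) :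
    DifferentiableAt ℝ (cofactorField F j) x := by
  have hd k : DifferentiableAt ℝ (F k) x := (hF k).differentiableAt (by norm_num)
  have hdd i k : DifferentiableAt ℝ (pd i (F k)) x :=
    ((hF k).pd (m := 1) (by norm_num) i).differentiableAt (by norm_num)
  unfold cofactorField
  fun_prop

lemma sum_pd_cofactorField (hF : ∀ k, ContDiffAt ℝ 2 (F k) x) :
    ∑ j, pd j (cofactorField F j) x =
      (∑ k, pd k (F k) x) ^ 2 - ∑ j, ∑ i, pd i (F j) x * pd j (F i) x := by
  have hd k : DifferentiableAt ℝ (F k) x := (hF k).differentiableAt (by norm_num)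
  have hdd i k : DifferentiableAt ℝ (pd i (F k)) x :=
    ((hF k).pd (m := 1) (by norm_num) i).differentiableAt (by norm_num)
  have hj (j : Fin n) : pd j (cofactorField F j) x =
      (∑ k, pd j (pd k (F k)) x) * F j x + (∑ k, pd k (F k) x) * pd j (F j) x
        - (∑ i, pd i (pd j (F j)) x * F i x + ∑ i, pd i (F j) x * pd j (F i) x) := by
    unfold cofactorField
    rw [pd_sub j (by fun_prop) (by fun_prop), pd_mul j (by fun_prop) (hd j),
      pd_sum j (fun k _ => hdd k k), pd_sum j (fun k _ => (hdd k j).fun_mul (hd k)),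
      ← Finset.sum_add_distrib]
    congr 1
    refine Finset.sum_congr rfl fun i _ => ?_
    rw [pd_mul j (hdd i j) (hd i), pd_pd_comm (hF j) j i]
  simp only [hj, Finset.sum_sub_distrib, Finset.sum_add_distrib, ← Finset.mul_sum]
  have hswap : ∑ j, (∑ k, pd j (pd k (F k)) x) * F j x
      = ∑ j, ∑ i, pd i (pd j (F j)) x * F i x := by
    simp only [Finset.sum_mul]
    exact Finset.sum_comm
  rw [hswap]
  ring

end Divergence

section Homogeneous

variable {n : ℕ} {H : Euc n → ℝ} {p : ℝ} {ξ : Euc n}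

lemma contDiffAt_Vfun {k : WithTop ℕ∞} (hH : ContDiffAt ℝ k H ξ) (h : H ξ ≠ 0) (p : ℝ) :
    ContDiffAt ℝ k (Vfun H p) ξ :=
  (hH.rpow_const_of_ne h).div_const p

lemma pd_Vfun (hp : p ≠ 0) (hH : DifferentiableAt ℝ H ξ) (h : H ξ ≠ 0) (i : Fin n) :
    pd i (Vfun H p) ξ = H ξ ^ (p - 1) * pd i H ξ := by
  have hV : Vfun H p = fun η => p⁻¹ * H η ^ p := by
    funext η
    simp only [Vfun]
    ring
  rw [hV, pd_const_mul, pd_rpow i hH h]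
  field_simp

/-- Euler's identity for a function that is absolutely homogeneous of degree one. -/
lemma sum_pd_mul_eq_of_homogeneous (hhomog : ∀ (t : ℝ) (ξ : Euc n), H (t • ξ) = |t| * H ξ)
    (hH : DifferentiableAt ℝ H ξ) : ∑ i, pd i H ξ * ξ i = H ξ := by
  rw [← fderiv_apply_eq_sum_pd]
  have hline : HasDerivAt (fun t : ℝ => t • ξ) ξ 1 := by
    simpa using (hasDerivAt_id (1 : ℝ)).smul_const ξ
  have hH' : HasFDerivAt H (fderiv ℝ H ξ) ((1 : ℝ) • ξ) := by
    simpa using hH.hasFDerivAt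
  have h₁ : HasDerivAt (fun t : ℝ => H (t • ξ)) (fderiv ℝ H ξ ξ) 1 :=
    hH'.comp_hasDerivAt 1 hline
  have h₂ : HasDerivAt (fun t : ℝ => H (t • ξ)) (H ξ) 1 := by
    have h₃ : HasDerivAt (fun t : ℝ => t * H ξ) (H ξ) 1 := by
      simpa using (hasDerivAt_id (1 : ℝ)).mul_const (H ξ)
    refine h₃.congr_of_eventuallyEq ?_
    filter_upwards [lt_mem_nhds (zero_lt_one' ℝ)] with t ht
    rw [hhomog, abs_of_pos ht]
  exact h₁.unique h₂

lemma sum_pd_Vfun_mul (hp : p ≠ 0)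
    (hhomog : ∀ (t : ℝ) (ξ : Euc n), H (t • ξ) = |t| * H ξ)
    (hH : DifferentiableAt ℝ H ξ) (h : 0 < H ξ) :
    ∑ i, pd i (Vfun H p) ξ * ξ i = p * Vfun H p ξ := by
  simp only [pd_Vfun hp hH h.ne', mul_assoc, ← Finset.mul_sum,
    sum_pd_mul_eq_of_homogeneous hhomog hH]
  rw [Vfun, mul_div_cancel₀ _ hp, ← Real.rpow_add_one h.ne', sub_add_cancel]

end Homogeneous

/-- pointwise differential identity for S₂ when V = H^p/p. -/
theorem S2_pointwise_identity_norm
    {N : ℕ} {p : ℝ} (hp : 1 < p)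
    {H : Euc N → ℝ} (hconv : ConvexOn ℝ Set.univ H)
    (hhomog : ∀ (t : ℝ) (ξ : Euc N), H (t • ξ) = |t| * H ξ)
    (hpos : ∀ ξ : Euc N, ξ ≠ 0 → 0 < H ξ)
    (hsm : ContDiffOn ℝ 3 H {(0 : Euc N)}ᶜ)
    {U : Set (Euc N)} (hU : IsOpen U)
    {v : Euc N → ℝ} (hv : ContDiffOn ℝ 3 v U) (hvpos : ∀ x ∈ U, 0 < v x)
    (hgrad : ∀ x ∈ U, gradient v x ≠ 0)
    (γ : ℝ) (x : Euc N) (hx : x ∈ U) :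
    2 * v x ^ γ * S2 (Wmat H p v x) =
      divVF (fun y =>
        toEuc (fun j => v y ^ γ * ∑ i, S2ij (Wmat H p v y) i j
          * gradient (Vfun H p) (gradient v y) i)
        + (γ * (p - 1) * v y ^ (γ - 1) * Vfun H p (gradient v y))
            • gradient (Vfun H p) (gradient v y)) x
      - γ * (γ - 1) * p * (p - 1) * v x ^ (γ - 2) * (Vfun H p (gradient v x)) ^ 2
      - γ * (2 * p - 1) * v x ^ (γ - 1) * Vfun H p (gradient v x) *
          divVF (fun y => H (gradient v y) ^ (p - 1) • gradient H (gradient v y)) x := by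
  have hp0 : p ≠ 0 := by positivity
  have hUn : ∀ y ∈ U, U ∈ 𝓝 y := fun y hy => hU.mem_nhds hy
  have hvC y (hy : y ∈ U) : ContDiffAt ℝ 3 v y := hv.contDiffAt (hUn y hy)
  have hHC y (hy : y ∈ U) : ContDiffAt ℝ 3 H (gradient v y) :=
    hsm.contDiffAt (isOpen_compl_singleton.mem_nhds (hgrad y hy))
  have hHpos y (hy : y ∈ U) : 0 < H (gradient v y) := hpos _ (hgrad y hy)
  have hHd y (hy : y ∈ U) : DifferentiableAt ℝ H (gradient v y) :=
    (hHC y hy).differentiableAt (by norm_num)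
  have hVC y (hy : y ∈ U) : ContDiffAt ℝ 3 (Vfun H p) (gradient v y) :=
    contDiffAt_Vfun (hHC y hy) (hHpos y hy).ne' p
  have hDvC y (hy : y ∈ U) : ContDiffAt ℝ 2 (gradient v) y :=
    (hvC y hy).gradient (by norm_num)
  have hDvd y (hy : y ∈ U) : DifferentiableAt ℝ (gradient v) y :=
    (hDvC y hy).differentiableAt (by norm_num)
  set F : Fin N → Euc N → ℝ := fun j y => pd j (Vfun H p) (gradient v y) with hFdef
  set G : Euc N → ℝ := fun y => Vfun H p (gradient v y) with hGdef
  have hFC j y (hy : y ∈ U) : ContDiffAt ℝ 2 (F j) y :=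
    ((hVC y hy).pd (by norm_num) j).comp y (hDvC y hy)
  have hFd j : DifferentiableAt ℝ (F j) x := (hFC j x hx).differentiableAt (by norm_num)
  have hGd : DifferentiableAt ℝ G x :=
    ((hVC x hx).differentiableAt (by norm_num)).comp x (hDvd x hx)
  have hvd : DifferentiableAt ℝ v x := (hvC x hx).differentiableAt (by norm_num)
  have hgd j : DifferentiableAt ℝ (pd j v) x :=
    ((hvC x hx).pd (m := 1) (by norm_num) j).differentiableAt (by norm_num)
  have hW y (hy : y ∈ U) i j : Wmat H p v y i j = pd j (F i) y := by
    have hV2 : ContDiffAt ℝ 2 (Vfun H p) (gradient v y) := (hVC y hy).of_le (by norm_num)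
    have hv2 : ContDiffAt ℝ 2 v y := (hvC y hy).of_le (by norm_num)
    rw [hFdef, pd_comp j
      ((hV2.pd (m := 1) (by norm_num) i).differentiableAt (by norm_num)) (hDvd y hy)]
    simp only [gradient_apply_eq_pd, Wmat, hessM, Matrix.mul_apply, Matrix.of_apply]
    refine Finset.sum_congr rfl fun k _ => ?_
    rw [pd_pd_comm hV2 i k, pd_pd_comm hv2 k j]
  have hEuler y (hy : y ∈ U) : ∑ j, F j y * pd j v y = p * G y := by
    simpa only [gradient_apply_eq_pd] using
      sum_pd_Vfun_mul hp0 hhomog (hHd y hy) (hHpos y hy)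
  have hGpd i : pd i G x = ∑ j, F j x * pd i (pd j v) x := by
    rw [hGdef, pd_comp i ((hVC x hx).differentiableAt (by norm_num)) (hDvd x hx)]
    simp only [gradient_apply_eq_pd]
    rfl
  have hWg i : ∑ j, pd i (F j) x * pd j v x = (p - 1) * pd i G x := by
    have h₁ : pd i (fun y => ∑ j, F j y * pd j v y) x = pd i (fun y => p * G y) x :=
      pd_congr i (by filter_upwards [hUn x hx] with y hy using hEuler y hy)
    rw [pd_const_mul, pd_sum i (fun j _ => (hFd j).fun_mul (hgd j))] at h₁
    simp only [pd_mul i (hFd _) (hgd _), Finset.sum_add_distrib, ← hGpd] at h₁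
    linarith
  have hdiv : divVF (fun y => H (gradient v y) ^ (p - 1) • gradient H (gradient v y)) x
      = ∑ j, pd j (F j) x := by
    refine Finset.sum_congr rfl fun j _ => pd_congr j ?_
    filter_upwards [hUn x hx] with y hy
    simp only [PiLp.smul_apply, smul_eq_mul, gradient_apply_eq_pd, hFdef]
    rw [pd_Vfun hp0 (hHd y hy) (hHpos y hy).ne']
  have hS2 : 2 * S2 (Wmat H p v x) = ∑ j, pd j (cofactorField F j) x := by
    rw [sum_pd_cofactorField (fun k => hFC k x hx)]
    simp only [S2, Matrix.trace, Matrix.diag, Matrix.mul_apply, hW x hx]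
    rw [Finset.sum_congr rfl fun j _ => Finset.sum_congr rfl fun i _ => mul_comm _ _]
    ring
  have hcof : ∑ j, pd j v x * cofactorField F j x
      = p * G x * (∑ j, pd j (F j) x) - (p - 1) * ∑ i, pd i G x * F i x := by
    have h₁ : ∑ j, pd j v x * ∑ i, pd i (F j) x * F i x
        = (p - 1) * ∑ i, pd i G x * F i x := by
      simp only [Finset.mul_sum]
      rw [Finset.sum_comm]
      refine Finset.sum_congr rfl fun i _ => ?_
      rw [← mul_assoc, ← hWg, Finset.sum_mul]
      exact Finset.sum_congr rfl fun j _ => by ring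
    simp only [cofactorField, mul_sub, Finset.sum_sub_distrib, h₁]
    rw [← hEuler x hx, Finset.sum_mul]
    exact congrArg (· - _) (Finset.sum_congr rfl fun j _ => by ring)
  have hfield : divVF (fun y =>
        toEuc (fun j => v y ^ γ * ∑ i, S2ij (Wmat H p v y) i j
          * gradient (Vfun H p) (gradient v y) i)
        + (γ * (p - 1) * v y ^ (γ - 1) * Vfun H p (gradient v y))
            • gradient (Vfun H p) (gradient v y)) x
      = ∑ j, pd j (fun y => v y ^ γ * cofactorField F j y
          + γ * (p - 1) * (v y ^ (γ - 1) * (G y * F j y))) x := by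
    refine Finset.sum_congr rfl fun j _ => pd_congr j ?_
    filter_upwards [hUn x hx] with y hy
    simp only [toEuc, WithLp.equiv_symm_apply, PiLp.add_apply, PiLp.smul_apply, smul_eq_mul,
      gradient_apply_eq_pd, S2ij, hW y hy, Matrix.trace, Matrix.diag, cofactorField, add_mul,
      ite_mul, zero_mul, Finset.sum_add_distrib, Finset.sum_ite_eq', Finset.mem_univ, if_true,
      neg_mul, Finset.sum_neg_distrib, hFdef, hGdef]
    ring
  have hv0 : v x ≠ 0 := (hvpos x hx).ne'
  have hvr (a : ℝ) : DifferentiableAt ℝ (fun y => v y ^ a) x := 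
    hvd.rpow_const (Or.inl hv0)
  have hcd j := differentiableAt_cofactorField (fun k => hFC k x hx) j
  have hterm j : pd j (fun y => v y ^ γ * cofactorField F j y
          + γ * (p - 1) * (v y ^ (γ - 1) * (G y * F j y))) x
      = v x ^ γ * pd j (cofactorField F j) x
        + γ * v x ^ (γ - 1) * (pd j v x * cofactorField F j x)
        + γ * (γ - 1) * (p - 1) * v x ^ (γ - 2) * G x * (F j x * pd j v x)
        + γ * (p - 1) * v x ^ (γ - 1) * (pd j G x * F j x)
        + γ * (p - 1) * v x ^ (γ - 1) * G x * pd j (F j) x := by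
    rw [pd_add j ((hvr γ).fun_mul (hcd j))
        (((hvr (γ - 1)).fun_mul (hGd.fun_mul (hFd j))).const_mul _),
      pd_const_mul, pd_mul j (hvr γ) (hcd j), pd_mul j (hvr (γ - 1)) (hGd.fun_mul (hFd j)),
      pd_mul j hGd (hFd j), pd_rpow j hvd hv0, pd_rpow j hvd hv0,
      show γ - 1 - 1 = γ - 2 by ring]
    ring
  rw [hfield, hdiv, Finset.sum_congr rfl fun j _ => hterm j]
  simp only [Finset.sum_add_distrib, ← Finset.mul_sum]
  rw [hcof, hEuler x hx, ← hS2]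
  ring

end
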